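/- Let t ≥ 3 be an integer, let n₁,…,n_t be positive integers with n = n₁ + ⋯ + n_t, and let N = ∏_{i=1}^t nᵢ. Then mass(ℱₜ) ≤ N · (n/t)^{t-2} · |ℱₜ|, where ℱₜ is the set of all forests on vertex set {1,…,t}. -/

import Mathlib

/-- The degree of vertex `v` in `G` (the number of neighbours of `v`). -/
noncomputable def deg {t : ℕ} (G : SimpleGraph (Fin t)) (v : Fin t) : ℕ :=
  (G.neighborSet v).ncard

/-- The mass of a graph `F` with respect to weights `w`: `∏ i, w i ^ d_F(i)`. -/
noncomputable def mass {t : ℕ} (w : Fin t → ℕ) (F : SimpleGraph (Fin t)) : ℝ :=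
  ∏ i, (w i : ℝ) ^ deg F i

/-- The total mass of a set of graphs. -/
noncomputable def massSet {t : ℕ} (w : Fin t → ℕ) (S : Set (SimpleGraph (Fin t))) : ℝ :=
  ∑ᶠ F ∈ S, mass w F

open Finset

/-- The total weight of rooted forests on `S` grafted below roots of total weight `x`, where each
vertex is weighted by its number of children: `x (x + w(S)) ^ (|S| - 1)`, and `1` if `S = ∅`. -/
noncomputable def graftWeight {ι : Type*} [DecidableEq ι] (w : ι → ℝ) (x : ℝ) (S : Finset ι) : ℝ :=
  if S = ∅ then 1 else x * (x + ∑ i ∈ S, w i) ^ (#S - 1)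

/-- The total weight of the trees on a block `B`, divided by the product of its weights:
`w(B) ^ (|B| - 2)`. -/
noncomputable def treeWeight {ι : Type*} (w : ι → ℝ) (B : Finset ι) : ℝ :=
  (∑ i ∈ B, w i) ^ #B / (∑ i ∈ B, w i) ^ 2

section Hurwitz

variable {ι : Type*} [DecidableEq ι]

theorem sum_powerset_pow_mul_sum_mul_pow (w : ι → ℝ) (x y : ℝ) (S : Finset ι) :
    ∑ U ∈ S.powerset, x ^ #U * (∑ i ∈ U, w i) * y ^ (#S - #U)
      = (∑ i ∈ S, w i) * x * (x + y) ^ (#S - 1) := by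
  induction S using Finset.induction_on with
  | empty => simp
  | insert a S ha ih =>
    rw [Finset.sum_powerset_insert ha, Finset.sum_insert ha, card_insert_of_notMem ha]
    have h1 : ∀ U ∈ S.powerset, x ^ #U * (∑ i ∈ U, w i) * y ^ (#S + 1 - #U)
        = y * (x ^ #U * (∑ i ∈ U, w i) * y ^ (#S - #U)) := by
      intro U hU
      have := card_le_card (mem_powerset.1 hU)
      rw [show #S + 1 - #U = (#S - #U) + 1 by omega]; ring
    have h2 : ∀ U ∈ S.powerset,
        x ^ #(insert a U) * (∑ i ∈ insert a U, w i) * y ^ (#S + 1 - #(insert a U))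
        = x * (x ^ #U * (∑ i ∈ U, w i) * y ^ (#S - #U)) + x * w a * (x ^ #U * y ^ (#S - #U)) := by
      intro U hU
      have haU : a ∉ U := fun h => ha (mem_powerset.1 hU h)
      rw [card_insert_of_notMem haU, sum_insert haU,
        show #S + 1 - (#U + 1) = #S - #U by omega]; ring
    rw [sum_congr rfl h1, sum_congr rfl h2, sum_add_distrib, ← mul_sum, ← mul_sum, ← mul_sum, ih,
      sum_pow_mul_eq_add_pow]
    rcases S.eq_empty_or_nonempty with rfl | hS
    · simp; ring
    · obtain ⟨k, hk⟩ : ∃ k, #S = k + 1 := ⟨#S - 1, by have := hS.card_pos; omega⟩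
      simp only [hk, Nat.add_sub_cancel]; ring

theorem sum_pow_mul_graftWeight {w : ι → ℝ} (hw : ∀ i, 0 < w i) (x : ℝ) (S : Finset ι) :
    ∑ U ∈ S.powerset, x ^ #U * graftWeight w (∑ i ∈ U, w i) (S \ U) = graftWeight w x S := by
  rcases S.eq_empty_or_nonempty with rfl | hS
  · simp [graftWeight]
  have hn : 0 < ∑ i ∈ S, w i := sum_pos (fun i _ => hw i) hS
  apply mul_left_cancel₀ hn.ne'
  have h : ∀ U ∈ S.powerset,
      (∑ i ∈ S, w i) * (x ^ #U * graftWeight w (∑ i ∈ U, w i) (S \ U))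
        = x ^ #U * (∑ i ∈ U, w i) * (∑ i ∈ S, w i) ^ (#S - #U) := by
    intro U hU
    rw [mem_powerset] at hU
    by_cases hSU : S \ U = ∅
    · obtain rfl : U = S := hU.antisymm (sdiff_eq_empty_iff_subset.1 hSU)
      simp [graftWeight]; ring
    · have hc : #(S \ U) = #S - #U := card_sdiff_of_subset hU
      have hpos : 0 < #(S \ U) := card_pos.2 (nonempty_iff_ne_empty.2 hSU)
      rw [graftWeight, if_neg hSU, add_comm (∑ i ∈ U, w i), sum_sdiff hU, hc]
      obtain ⟨k, hk⟩ : ∃ k, #S - #U = k + 1 := ⟨#S - #U - 1, by omega⟩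
      simp only [hk, Nat.add_sub_cancel]; ring
  rw [mul_sum, sum_congr rfl h, sum_powerset_pow_mul_sum_mul_pow, graftWeight,
    if_neg hS.ne_empty]
  ring

/-- Both sides sum `f` over the ways to split `S` into four labelled parts. -/
theorem sum_powerset_four_parts (f : Finset ι → Finset ι → Finset ι → Finset ι → ℝ)
    (S : Finset ι) :
    ∑ A ∈ S.powerset, ∑ V ∈ A.powerset, ∑ W ∈ (S \ A).powerset, f V W (A \ V) ((S \ A) \ W)
      = ∑ U ∈ S.powerset, ∑ V ∈ U.powerset, ∑ A ∈ (S \ U).powerset,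
          f V (U \ V) A ((S \ U) \ A) := by
  simp only [sum_sigma']
  refine sum_bij' (fun x _ => ⟨x.2.1 ∪ x.2.2, x.2.1, x.1 \ x.2.1⟩)
    (fun x _ => ⟨x.2.1 ∪ x.2.2, x.2.1, x.1 \ x.2.1⟩) ?_ ?_ ?_ ?_ ?_
  · rintro ⟨A, V, W⟩ h
    simp only [mem_sigma, mem_powerset] at h ⊢
    grind
  · rintro ⟨A, V, W⟩ h
    simp only [mem_sigma, mem_powerset] at h ⊢
    grind
  · rintro ⟨A, V, W⟩ h
    simp only [mem_sigma, mem_powerset, Sigma.mk.injEq, heq_eq_eq] at h ⊢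
    grind
  · rintro ⟨A, V, W⟩ h
    simp only [mem_sigma, mem_powerset, Sigma.mk.injEq, heq_eq_eq] at h ⊢
    grind
  · rintro ⟨A, V, W⟩ h
    simp only [mem_sigma, mem_powerset] at h ⊢
    congr 1 <;> grind

/-- The Hurwitz generalisation of the Abel binomial identity. -/
theorem sum_graftWeight_mul_graftWeight {w : ι → ℝ} (hw : ∀ i, 0 < w i) (x y : ℝ)
    (S : Finset ι) :
    ∑ A ∈ S.powerset, graftWeight w x A * graftWeight w y (S \ A) = graftWeight w (x + y) S := by
  induction S using Finset.strongInduction generalizing x y with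
  | H S ih =>
  rcases S.eq_empty_or_nonempty with rfl | hS
  · simp [graftWeight]
  have hzero : ∀ T : Finset ι, T.Nonempty → graftWeight w 0 T = 0 := by
    intro T hT; simp [graftWeight, hT.ne_empty]
  have hexp : ∀ A ∈ S.powerset, graftWeight w x A * graftWeight w y (S \ A)
      = ∑ V ∈ A.powerset, ∑ W ∈ (S \ A).powerset,
        x ^ #V * y ^ #W * (graftWeight w (∑ i ∈ V, w i) (A \ V)
          * graftWeight w (∑ i ∈ W, w i) ((S \ A) \ W)) := by
    intro A _
    rw [← sum_pow_mul_graftWeight hw x A, ← sum_pow_mul_graftWeight hw y (S \ A), sum_mul_sum]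
    exact sum_congr rfl fun V _ => sum_congr rfl fun W _ => by ring
  rw [sum_congr rfl hexp, sum_powerset_four_parts (fun V W A B => x ^ #V * y ^ #W *
    (graftWeight w (∑ i ∈ V, w i) A * graftWeight w (∑ i ∈ W, w i) B)),
    ← sum_pow_mul_graftWeight hw (x + y) S]
  refine sum_congr rfl fun U hU => ?_
  rw [mem_powerset] at hU
  have hinner : ∀ V ∈ U.powerset, ∑ A ∈ (S \ U).powerset,
      x ^ #V * y ^ #(U \ V) * (graftWeight w (∑ i ∈ V, w i) A
        * graftWeight w (∑ i ∈ U \ V, w i) ((S \ U) \ A))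
      = x ^ #V * y ^ (#U - #V) * graftWeight w (∑ i ∈ U, w i) (S \ U) := by
    intro V hV
    rw [mem_powerset] at hV
    rw [← mul_sum, card_sdiff_of_subset hV]
    congr 1
    rcases U.eq_empty_or_nonempty with rfl | hUne
    · obtain rfl : V = ∅ := subset_empty.1 hV
      simp only [sum_empty, sdiff_empty, hzero S hS, sdiff_self]
      refine sum_eq_zero fun A _ => ?_
      rcases A.eq_empty_or_nonempty with rfl | hA
      · simp [hzero S hS]
      · simp [hzero A hA]
    · rw [ih (S \ U) (sdiff_ssubset hU hUne), add_comm, sum_sdiff hV]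
  rw [sum_congr rfl hinner, ← sum_mul, sum_pow_mul_eq_add_pow]

theorem graftWeight_eq_mul_treeWeight {w : ι → ℝ} (hw : ∀ i, 0 < w i) {p : ι} {S : Finset ι}
    (hp : p ∉ S) : graftWeight w (w p) S = w p * treeWeight w (insert p S) := by
  rw [graftWeight, treeWeight, sum_insert hp, card_insert_of_notMem hp]
  have hn : 0 < w p + ∑ i ∈ S, w i :=
    add_pos_of_pos_of_nonneg (hw p) (sum_nonneg fun i _ => (hw i).le)
  split_ifs with h
  · subst h
    have := hw p
    simp; field_simp
  · obtain ⟨k, hk⟩ : ∃ k, #S = k + 1 :=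
      ⟨#S - 1, by have := (nonempty_iff_ne_empty.2 h).card_pos; omega⟩
    simp only [hk, Nat.add_sub_cancel]
    field_simp
    ring

/-- The weighted count of the trees on `B` containing a given edge `pq`. -/
theorem sum_treeWeight_separating {w : ι → ℝ} (hw : ∀ i, 0 < w i) {p q : ι} (hpq : p ≠ q)
    {B : Finset ι} (hp : p ∈ B) (hq : q ∈ B) :
    ∑ A ∈ B.powerset with p ∈ A ∧ q ∉ A, w p * w q * (treeWeight w A * treeWeight w (B \ A))
      = (w p + w q) * (treeWeight w B / ∑ i ∈ B, w i) := by
  set S := B \ {p, q} with hS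
  have hpS : p ∉ S := by simp [hS]
  have hqS : q ∉ S := by simp [hS]
  have hB : B = insert p (insert q S) := by grind
  have hr : graftWeight w (w p + w q) S = (w p + w q) * (treeWeight w B / ∑ i ∈ B, w i) := by
    have hn : 0 < w p + w q + ∑ i ∈ S, w i :=
      add_pos_of_pos_of_nonneg (add_pos (hw p) (hw q)) (sum_nonneg fun i _ => (hw i).le)
    have hpqS : p ∉ insert q S := by simp [hpq, hpS]
    rw [graftWeight, treeWeight, hB, sum_insert hpqS, sum_insert hqS, card_insert_of_notMem hpqS,
      card_insert_of_notMem hqS, ← add_assoc]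
    split_ifs with h
    · rw [h]
      rw [h] at hn
      simp at hn ⊢; field_simp
    · obtain ⟨k, hk⟩ : ∃ k, #S = k + 1 :=
        ⟨#S - 1, by have := (nonempty_iff_ne_empty.2 h).card_pos; omega⟩
      simp only [hk, Nat.add_sub_cancel]
      field_simp
      ring
  rw [← hr, ← sum_graftWeight_mul_graftWeight hw]
  refine sum_bij' (fun A _ => A.erase p) (fun A _ => insert p A) ?_ ?_ ?_ ?_ ?_
  · intro A hA
    simp only [mem_filter, mem_powerset] at hA ⊢
    grind
  · intro A hA
    simp only [mem_filter, mem_powerset] at hA ⊢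
    grind
  · intro A hA
    simp only [mem_filter, mem_powerset] at hA ⊢
    grind
  · intro A hA
    simp only [mem_powerset] at hA ⊢
    grind
  · intro A hA
    simp only [mem_filter, mem_powerset] at hA
    rw [graftWeight_eq_mul_treeWeight hw (by simp), graftWeight_eq_mul_treeWeight hw (by grind),
      insert_erase hA.2.1, show insert q (S \ A.erase p) = B \ A by grind]
    ring

theorem sum_offDiag_add (w : ι → ℝ) (B : Finset ι) :
    ∑ e ∈ B.offDiag, (w e.1 + w e.2) = 2 * (#B - 1 : ℝ) * ∑ i ∈ B, w i := by
  have h1 : ∑ e ∈ B ×ˢ B, (w e.1 + w e.2) = 2 * #B * ∑ i ∈ B, w i := by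
    rw [sum_product]
    simp only [sum_add_distrib, sum_const, nsmul_eq_mul, ← mul_sum]
    ring
  have h2 : ∑ e ∈ B.diag, (w e.1 + w e.2) = 2 * ∑ i ∈ B, w i := by
    rw [sum_diag, mul_sum]
    exact sum_congr rfl fun i _ => by ring
  have h3 := sum_union (disjoint_diag_offDiag B) (f := fun e : ι × ι => w e.1 + w e.2)
  rw [diag_union_offDiag, h1, h2] at h3
  linarith

/-- Double counting of the pairs of a tree on `B` and an oriented edge of it. -/
theorem sum_offDiag_sum_treeWeight {w : ι → ℝ} (hw : ∀ i, 0 < w i) {B : Finset ι}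
    (hB : B.Nonempty) :
    ∑ e ∈ B.offDiag, ∑ A ∈ B.powerset with e.1 ∈ A ∧ e.2 ∉ A,
        w e.1 * w e.2 * (treeWeight w A * treeWeight w (B \ A))
      = 2 * (#B - 1 : ℝ) * treeWeight w B := by
  have h : ∀ e ∈ B.offDiag, ∑ A ∈ B.powerset with e.1 ∈ A ∧ e.2 ∉ A,
        w e.1 * w e.2 * (treeWeight w A * treeWeight w (B \ A))
      = (w e.1 + w e.2) * (treeWeight w B / ∑ i ∈ B, w i) := by
    intro e he
    rw [mem_offDiag] at he
    exact sum_treeWeight_separating hw he.2.2 he.1 he.2.1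
  have hn : 0 < ∑ i ∈ B, w i := sum_pos (fun i _ => hw i) hB
  rw [sum_congr rfl h, ← sum_mul, sum_offDiag_add]
  field_simp

end Hurwitz

section Blocks

variable {V : Type*}

/-- `P` is the set of blocks of a partition of `V`. -/
structure IsBlocks (P : Finset (Finset V)) : Prop where
  nonempty : ∀ B ∈ P, B.Nonempty
  exists_mem : ∀ v, ∃ B ∈ P, v ∈ B
  eq_of_mem : ∀ B ∈ P, ∀ C ∈ P, ∀ v, v ∈ B → v ∈ C → B = C

theorem IsBlocks.notMem_of_ssubset {P : Finset (Finset V)} (hP : IsBlocks P) {B A : Finset V}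
    (hB : B ∈ P) (hA : A ⊂ B) : A ∉ P := by
  intro h
  obtain ⟨v, hv⟩ := hP.nonempty A h
  exact hA.ne (hP.eq_of_mem A h B hB v hv (hA.subset hv))

variable [DecidableEq V]

/-- Replace the block `B` by the two blocks `A` and `B \ A`. -/
def splitBlock (P : Finset (Finset V)) (B A : Finset V) : Finset (Finset V) :=
  insert A (insert (B \ A) (P.erase B))

theorem mem_splitBlock {P : Finset (Finset V)} {B A C : Finset V} :
    C ∈ splitBlock P B A ↔ C = A ∨ C = B \ A ∨ C ≠ B ∧ C ∈ P := by
  simp [splitBlock]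

theorem IsBlocks.splitBlock {P : Finset (Finset V)} (hP : IsBlocks P) {B A : Finset V}
    (hB : B ∈ P) (hA : A ⊆ B) {p q : V} (hp : p ∈ A) (hqB : q ∈ B) (hqA : q ∉ A) :
    IsBlocks (splitBlock P B A) where
  nonempty C hC := by
    rcases mem_splitBlock.1 hC with rfl | rfl | h
    · exact ⟨p, hp⟩
    · exact ⟨q, mem_sdiff.2 ⟨hqB, hqA⟩⟩
    · exact hP.nonempty C h.2
  exists_mem v := by
    obtain ⟨C, hC, hv⟩ := hP.exists_mem v
    simp only [mem_splitBlock]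
    by_cases hCB : C = B
    · by_cases hvA : v ∈ A
      · exact ⟨A, by simp, hvA⟩
      · exact ⟨B \ A, by simp, by grind⟩
    · exact ⟨C, by simp [hCB, hC], hv⟩
  eq_of_mem C hC D hD v hvC hvD := by
    have := hP.eq_of_mem
    simp only [mem_splitBlock] at hC hD
    grind

theorem IsBlocks.prod_splitBlock {P : Finset (Finset V)} (hP : IsBlocks P) {B A : Finset V}
    (hB : B ∈ P) (hA : A ⊆ B) {p q : V} (hp : p ∈ A) (hqB : q ∈ B) (hqA : q ∉ A)
    (f : Finset V → ℝ) :
    ∏ C ∈ _root_.splitBlock P B A, f C = f A * (f (B \ A) * ∏ C ∈ P.erase B, f C) := by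
  have h1 : A ∉ P := hP.notMem_of_ssubset hB ⟨hA, fun h => hqA (h hqB)⟩
  have h2 : B \ A ∉ P := hP.notMem_of_ssubset hB
    ⟨sdiff_subset, fun h => (mem_sdiff.1 (h (hA hp))).2 hp⟩
  have h3 : A ≠ B \ A := by grind
  rw [_root_.splitBlock, prod_insert (by simp [h1, h3]), prod_insert (by simp [h2])]

theorem IsBlocks.card_splitBlock {P : Finset (Finset V)} (hP : IsBlocks P) {B A : Finset V}
    (hB : B ∈ P) (hA : A ⊆ B) {p q : V} (hp : p ∈ A) (hqB : q ∈ B) (hqA : q ∉ A) :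
    #(_root_.splitBlock P B A) = #P + 1 := by
  have h1 : A ∉ P := hP.notMem_of_ssubset hB ⟨hA, fun h => hqA (h hqB)⟩
  have h2 : B \ A ∉ P := hP.notMem_of_ssubset hB
    ⟨sdiff_subset, fun h => (mem_sdiff.1 (h (hA hp))).2 hp⟩
  have h3 : A ≠ B \ A := by grind
  have := card_pos.2 ⟨B, hB⟩
  rw [_root_.splitBlock, card_insert_of_notMem (by simp [h1, h3]),
    card_insert_of_notMem (by simp [h2]), card_erase_of_mem hB]
  omega

theorem IsBlocks.sum_blocks [Fintype V] {P : Finset (Finset V)} (hP : IsBlocks P) (f : V → ℝ) :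
    ∑ B ∈ P, ∑ v ∈ B, f v = ∑ v, f v := by
  have hd : (P : Set (Finset V)).PairwiseDisjoint fun B => B := by
    intro B hB C hC hne
    exact disjoint_left.2 fun v hv hv' => hne (hP.eq_of_mem B hB C hC v hv hv')
  rw [← sum_biUnion hd]
  congr 1
  ext v
  simpa using hP.exists_mem v

theorem IsBlocks.sum_card [Fintype V] {P : Finset (Finset V)} (hP : IsBlocks P) :
    ∑ B ∈ P, (#B : ℝ) = Fintype.card V := by
  simpa using hP.sum_blocks (fun _ => 1)

end Blocks

section Components

variable {V : Type*}

theorem reachable_sup_edge_iff {G : SimpleGraph V} {p q u v : V} :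
    (G ⊔ SimpleGraph.edge p q).Reachable u v ↔ G.Reachable u v ∨
      (G.Reachable u p ∧ G.Reachable q v) ∨ (G.Reachable u q ∧ G.Reachable p v) := by
  constructor
  · rintro ⟨W⟩
    induction W with
    | nil => exact .inl .rfl
    | @cons a b c hadj W ih =>
      rw [SimpleGraph.sup_adj, SimpleGraph.edge_adj] at hadj
      rcases hadj with h | ⟨⟨rfl, rfl⟩ | ⟨rfl, rfl⟩, -⟩
      · have := h.reachable
        rcases ih with h1 | h1 | h1
        · exact .inl (this.trans h1)
        · exact .inr (.inl ⟨this.trans h1.1, h1.2⟩)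
        · exact .inr (.inr ⟨this.trans h1.1, h1.2⟩)
      · rcases ih with h1 | h1 | h1
        · exact .inr (.inl ⟨.rfl, h1⟩)
        · exact .inr (.inl ⟨.rfl, h1.2⟩)
        · exact .inl h1.2
      · rcases ih with h1 | h1 | h1
        · exact .inr (.inr ⟨.rfl, h1⟩)
        · exact .inl h1.2
        · exact .inr (.inr ⟨.rfl, h1.2⟩)
  · have hle : G ≤ G ⊔ SimpleGraph.edge p q := le_sup_left
    have hpq : (G ⊔ SimpleGraph.edge p q).Reachable p q := by
      by_cases h : p = q
      · rw [h]
      · exact SimpleGraph.Adj.reachable (by simp [SimpleGraph.edge_adj, h])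
    rintro (h | h | h)
    · exact h.mono hle
    · exact (h.1.mono hle).trans (hpq.trans (h.2.mono hle))
    · exact (h.1.mono hle).trans (hpq.symm.trans (h.2.mono hle))

variable [Fintype V] [DecidableEq V]

open Classical in
/-- The vertex set of the connected component of `v` in `G`. -/
noncomputable def component (G : SimpleGraph V) (v : V) : Finset V :=
  univ.filter (G.Reachable v)

/-- The vertex sets of the connected components of `G`. -/
noncomputable def components (G : SimpleGraph V) : Finset (Finset V) :=
  univ.image (component G)

theorem mem_component {G : SimpleGraph V} {u v : V} : u ∈ component G v ↔ G.Reachable v u := by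
  simp [component]

theorem component_mem_components (G : SimpleGraph V) (v : V) : component G v ∈ components G :=
  mem_image_of_mem _ (mem_univ v)

theorem isBlocks_components (G : SimpleGraph V) : IsBlocks (components G) where
  nonempty B hB := by
    obtain ⟨v, -, rfl⟩ := mem_image.1 hB
    exact ⟨v, mem_component.2 .rfl⟩
  exists_mem v := ⟨_, component_mem_components G v, mem_component.2 .rfl⟩
  eq_of_mem B hB C hC v hv hv' := by
    obtain ⟨x, -, rfl⟩ := mem_image.1 hB
    obtain ⟨y, -, rfl⟩ := mem_image.1 hC
    rw [mem_component] at hv hv'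
    ext z
    rw [mem_component, mem_component]
    exact ⟨fun h => hv'.trans (hv.symm.trans h), fun h => hv.trans (hv'.symm.trans h)⟩

theorem reachable_iff_mem_components {G : SimpleGraph V} {u v : V} :
    G.Reachable u v ↔ ∃ B ∈ components G, u ∈ B ∧ v ∈ B := by
  constructor
  · exact fun h => ⟨_, component_mem_components G u, mem_component.2 .rfl, mem_component.2 h⟩
  · rintro ⟨B, hB, hu, hv⟩
    obtain ⟨x, -, rfl⟩ := mem_image.1 hB
    exact (mem_component.1 hu).symm.trans (mem_component.1 hv)

theorem components_eq_iff {P : Finset (Finset V)} (hP : IsBlocks P) {G : SimpleGraph V} :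
    components G = P ↔ ∀ u v, G.Reachable u v ↔ ∃ B ∈ P, u ∈ B ∧ v ∈ B := by
  constructor
  · rintro rfl u v
    exact reachable_iff_mem_components
  · intro h
    have key : ∀ B ∈ P, ∀ v ∈ B, component G v = B := by
      intro B hB v hv
      ext u
      rw [mem_component, h]
      constructor
      · rintro ⟨C, hC, hvC, huC⟩
        rwa [hP.eq_of_mem B hB C hC v hv hvC]
      · exact fun hu => ⟨B, hB, hv, hu⟩
    ext B
    constructor
    · intro hB
      obtain ⟨v, -, rfl⟩ := mem_image.1 hB
      obtain ⟨C, hC, hv⟩ := hP.exists_mem v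
      rwa [key C hC v hv]
    · intro hB
      obtain ⟨v, hv⟩ := hP.nonempty B hB
      rw [← key B hB v hv]
      exact component_mem_components G v

theorem components_sup_edge {P : Finset (Finset V)} (hP : IsBlocks P) {B A : Finset V}
    (hB : B ∈ P) (hA : A ⊆ B) {p q : V} (hp : p ∈ A) (hqB : q ∈ B) (hqA : q ∉ A)
    {G : SimpleGraph V} (hG : components G = splitBlock P B A) :
    components (G ⊔ SimpleGraph.edge p q) = P := by
  have hR := (components_eq_iff (hP.splitBlock hB hA hp hqB hqA)).1 hG
  have hRp : ∀ u, G.Reachable u p ↔ u ∈ A := by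
    intro u
    rw [hR]
    constructor
    · rintro ⟨C, hC, hu, hpC⟩
      rwa [(hP.splitBlock hB hA hp hqB hqA).eq_of_mem A (by simp [mem_splitBlock]) C hC p hp hpC]
    · exact fun hu => ⟨A, by simp [mem_splitBlock], hu, hp⟩
  have hRq : ∀ u, G.Reachable u q ↔ u ∈ B \ A := by
    intro u
    have hq : q ∈ B \ A := mem_sdiff.2 ⟨hqB, hqA⟩
    rw [hR]
    constructor
    · rintro ⟨C, hC, hu, hqC⟩
      rwa [(hP.splitBlock hB hA hp hqB hqA).eq_of_mem (B \ A) (by simp [mem_splitBlock]) C hC q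
        hq hqC]
    · exact fun hu => ⟨B \ A, by simp [mem_splitBlock], hu, hq⟩
  rw [components_eq_iff hP]
  intro u v
  rw [reachable_sup_edge_iff, SimpleGraph.reachable_comm (u := q),
    SimpleGraph.reachable_comm (u := p), hRp, hRp, hRq, hRq, hR]
  simp only [mem_splitBlock]
  constructor
  · rintro (⟨C, rfl | rfl | hC, hu, hv⟩ | h | h)
    · exact ⟨B, hB, hA hu, hA hv⟩
    · exact ⟨B, hB, (mem_sdiff.1 hu).1, (mem_sdiff.1 hv).1⟩
    · exact ⟨C, hC.2, hu, hv⟩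
    · exact ⟨B, hB, hA h.1, (mem_sdiff.1 h.2).1⟩
    · exact ⟨B, hB, (mem_sdiff.1 h.1).1, hA h.2⟩
  · rintro ⟨C, hC, hu, hv⟩
    by_cases hCB : C = B
    · subst hCB
      by_cases hu' : u ∈ A <;> by_cases hv' : v ∈ A
      · exact .inl ⟨A, .inl rfl, hu', hv'⟩
      · exact .inr (.inl ⟨hu', mem_sdiff.2 ⟨hv, hv'⟩⟩)
      · exact .inr (.inr ⟨mem_sdiff.2 ⟨hu, hu'⟩, hv'⟩)
      · exact .inl ⟨C \ A, .inr (.inl rfl), mem_sdiff.2 ⟨hu, hu'⟩, mem_sdiff.2 ⟨hv, hv'⟩⟩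
    · exact .inl ⟨C, .inr (.inr ⟨hCB, hC⟩), hu, hv⟩

theorem component_subset_of_sup_edge {G : SimpleGraph V} {B : Finset V} {p q : V}
    (hB : B ∈ components (G ⊔ SimpleGraph.edge p q)) (hp : p ∈ B) : component G p ⊆ B := by
  intro u hu
  obtain ⟨x, -, rfl⟩ := mem_image.1 hB
  rw [mem_component] at *
  exact hp.trans (hu.mono le_sup_left)

theorem components_eq_splitBlock {G : SimpleGraph V} {B : Finset V} {p q : V}
    (hpq : ¬ G.Reachable p q) (hB : B ∈ components (G ⊔ SimpleGraph.edge p q)) (hp : p ∈ B)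
    (hq : q ∈ B) :
    components G = splitBlock (components (G ⊔ SimpleGraph.edge p q)) B (component G p) := by
  set P := components (G ⊔ SimpleGraph.edge p q) with hPdef
  have hP : IsBlocks P := isBlocks_components _
  have hA : component G p ⊆ B := component_subset_of_sup_edge hB hp
  have hpA : p ∈ component G p := mem_component.2 .rfl
  have hqA : q ∉ component G p := fun h => hpq (mem_component.1 h)
  have hmem : ∀ u, u ∈ B ↔ G.Reachable p u ∨ G.Reachable q u := by
    intro u
    have h1 : u ∈ B ↔ (G ⊔ SimpleGraph.edge p q).Reachable p u := by
      rw [reachable_iff_mem_components]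
      exact ⟨fun hu => ⟨B, hB, hp, hu⟩,
        fun ⟨C, hC, hpC, hu⟩ => by rwa [hP.eq_of_mem B hB C hC p hp hpC]⟩
    rw [h1, reachable_sup_edge_iff]
    have h2 : G.Reachable p p := .rfl
    tauto
  rw [components_eq_iff (hP.splitBlock hB hA hpA hq hqA)]
  intro u v
  simp only [mem_splitBlock]
  constructor
  · intro h
    obtain ⟨C, hC, hu, hv⟩ := reachable_iff_mem_components.1
      (h.mono (le_sup_left : G ≤ G ⊔ SimpleGraph.edge p q))
    by_cases hCB : C = B
    · by_cases hu' : G.Reachable p u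
      · exact ⟨_, .inl rfl, mem_component.2 hu', mem_component.2 (hu'.trans h)⟩
      · exact ⟨_, .inr (.inl rfl), mem_sdiff.2 ⟨hCB ▸ hu, fun h' => hu' (mem_component.1 h')⟩,
          mem_sdiff.2 ⟨hCB ▸ hv, fun h' => hu' ((mem_component.1 h').trans h.symm)⟩⟩
    · exact ⟨C, .inr (.inr ⟨hCB, hC⟩), hu, hv⟩
  · rintro ⟨C, rfl | rfl | hC, hu, hv⟩
    · exact (mem_component.1 hu).symm.trans (mem_component.1 hv)
    · simp only [mem_sdiff, mem_component, hmem] at hu hv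
      exact (hu.1.resolve_left hu.2).symm.trans (hv.1.resolve_left hv.2)
    · have h := reachable_iff_mem_components.2 ⟨C, hC.2, hu, hv⟩
      have huB : u ∉ B := fun h' => hC.1 (hP.eq_of_mem C hC.2 B hB u hu h')
      rw [hmem, not_or] at huB
      rcases reachable_sup_edge_iff.1 h with h | h | h
      · exact h
      · exact absurd h.1.symm huB.1
      · exact absurd h.1.symm huB.2

end Components

section Forests

variable {t : ℕ}

open Classical in
/-- The forests whose components have the vertex sets `P`. -/
noncomputable def forestsOn (P : Finset (Finset (Fin t))) : Finset (SimpleGraph (Fin t)) :=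
  univ.filter fun F => F.IsAcyclic ∧ components F = P

theorem mem_forestsOn {P : Finset (Finset (Fin t))} {F : SimpleGraph (Fin t)} :
    F ∈ forestsOn P ↔ F.IsAcyclic ∧ components F = P := by
  simp [forestsOn]

theorem deg_sup_edge {F : SimpleGraph (Fin t)} {p q : Fin t} (hpq : p ≠ q) (h : ¬ F.Adj p q)
    (i : Fin t) :
    deg (F ⊔ SimpleGraph.edge p q) i
      = deg F i + (if i = p then 1 else 0) + (if i = q then 1 else 0) := by
  have hN : (F ⊔ SimpleGraph.edge p q).neighborSet i = F.neighborSet i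
      ∪ ((if i = p then {q} else ∅) ∪ (if i = q then {p} else ∅)) := by
    ext j
    simp only [SimpleGraph.mem_neighborSet, SimpleGraph.sup_adj, SimpleGraph.edge_adj, Set.mem_union]
    split_ifs <;> simp <;> grind
  rw [deg, deg, hN]
  have h' : ¬ F.Adj q p := fun hh => h hh.symm
  by_cases hp : i = p
  · subst hp
    simp only [hpq, if_true, if_false, Set.union_empty]
    rw [Set.union_singleton, Set.ncard_insert_of_notMem (by simpa using h)]
  · by_cases hq : i = q
    · subst hq
      simp only [hp, if_true, if_false, Set.empty_union]
      rw [Set.union_singleton, Set.ncard_insert_of_notMem (by simpa using h')]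
    · simp [hp, hq]

theorem mass_sup_edge (w : Fin t → ℕ) {F : SimpleGraph (Fin t)} {p q : Fin t} (hpq : p ≠ q)
    (h : ¬ F.Adj p q) : mass w (F ⊔ SimpleGraph.edge p q) = w p * w q * mass w F := by
  simp only [mass, deg_sup_edge hpq h, pow_add, prod_mul_distrib, pow_ite, pow_one, pow_zero,
    prod_ite_eq', mem_univ, if_true]
  ring

theorem deleteEdges_sup_edge_eq {F : SimpleGraph (Fin t)} {p q : Fin t} (h : F.Adj p q) :
    F.deleteEdges {s(p, q)} ⊔ SimpleGraph.edge p q = F := by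
  ext a b
  simp only [SimpleGraph.sup_adj, SimpleGraph.deleteEdges_adj, SimpleGraph.edge_adj,
    Set.mem_singleton_iff, Sym2.eq_iff]
  have := h.symm
  have := h.ne
  grind

theorem sup_edge_deleteEdges_eq {F : SimpleGraph (Fin t)} {p q : Fin t} (h : ¬ F.Adj p q) :
    (F ⊔ SimpleGraph.edge p q).deleteEdges {s(p, q)} = F := by
  ext a b
  simp only [SimpleGraph.sup_adj, SimpleGraph.deleteEdges_adj, SimpleGraph.edge_adj,
    Set.mem_singleton_iff, Sym2.eq_iff]
  have : ¬ F.Adj q p := fun hh => h hh.symm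
  grind

theorem not_reachable_deleteEdges {F : SimpleGraph (Fin t)} (hF : F.IsAcyclic) {p q : Fin t}
    (h : F.Adj p q) : ¬ (F.deleteEdges {s(p, q)}).Reachable p q :=
  SimpleGraph.isBridge_iff.1 (SimpleGraph.isAcyclic_iff_forall_adj_isBridge.1 hF h)

theorem components_bot : components (⊥ : SimpleGraph (Fin t)) = univ.image fun v => {v} := by
  rw [components]
  congr 1
  ext v u
  simp [mem_component, SimpleGraph.reachable_bot, eq_comm]

/-- A forest has as many edges as vertices minus components. -/
theorem sum_deg_add_two_mul_card_components (F : SimpleGraph (Fin t)) (hF : F.IsAcyclic) :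
    ∑ i, deg F i + 2 * #(components F) = 2 * t := by
  induction F using WellFoundedLT.induction with
  | ind F ih =>
  by_cases hbot : F = ⊥
  · subst hbot
    rw [components_bot, card_image_of_injective _ singleton_injective]
    simp [deg]
  · obtain ⟨p, q, hadj⟩ := SimpleGraph.ne_bot_iff_exists_adj.1 hbot
    have hnr := not_reachable_deleteEdges hF hadj
    have heq := deleteEdges_sup_edge_eq hadj
    set G := F.deleteEdges {s(p, q)} with hG
    have hnadj : ¬ G.Adj p q := fun h => hnr h.reachable
    have hle : G ≤ F := SimpleGraph.deleteEdges_le _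
    have hlt : G < F := lt_of_le_of_ne hle fun h => hnadj (h ▸ hadj)
    have hind := ih G hlt (hF.anti hle)
    have hB := component_mem_components F p
    have hq : q ∈ component F p := mem_component.2 hadj.reachable
    have hp : p ∈ component F p := mem_component.2 .rfl
    have hc := components_eq_splitBlock hnr (by rw [heq]; exact hB) hp hq
    have hA := component_subset_of_sup_edge (q := q) (G := G) (by rw [heq]; exact hB) hp
    rw [heq] at hc
    rw [hc, (isBlocks_components F).card_splitBlock hB hA (mem_component.2 .rfl) hq
      (fun h => hnr (mem_component.1 h))] at hind
    have hd : ∑ i, deg F i = ∑ i, deg G i + 2 := by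
      conv_lhs => rw [← heq]
      simp [deg_sup_edge hadj.ne hnadj, sum_add_distrib]
    omega

open Classical in
theorem sum_deg_eq_sum_offDiag {P : Finset (Finset (Fin t))} {F : SimpleGraph (Fin t)}
    (hF : components F = P) :
    (∑ i, (deg F i : ℝ)) = ∑ B ∈ P, ∑ e ∈ B.offDiag, if F.Adj e.1 e.2 then 1 else 0 := by
  subst hF
  have hP := isBlocks_components F
  have hd : (components F : Set (Finset (Fin t))).PairwiseDisjoint fun B => B.offDiag := by
    intro B hB C hC hne
    refine disjoint_left.2 fun e he he' => hne ?_
    exact hP.eq_of_mem B hB C hC e.1 (mem_offDiag.1 he).1 (mem_offDiag.1 he').1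
  have h1 : ∀ i, (deg F i : ℝ) = ∑ j, if F.Adj i j then 1 else 0 := by
    intro i
    rw [deg, Set.ncard_eq_toFinset_card', sum_boole]
    congr 2
    ext j
    simp
  rw [← sum_biUnion hd, sum_congr rfl fun i _ => h1 i, ← sum_product']
  symm
  refine sum_subset (subset_univ _) fun e _ he => if_neg fun hadj => he ?_
  exact mem_biUnion.2 ⟨_, component_mem_components F e.1,
    mem_offDiag.2 ⟨mem_component.2 .rfl, mem_component.2 hadj.reachable, hadj.ne⟩⟩

open Classical in
/-- Deleting the edge `pq` from a forest splits the component containing it. -/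
theorem sum_mass_adj (w : Fin t → ℕ) {P : Finset (Finset (Fin t))} (hP : IsBlocks P)
    {B : Finset (Fin t)} (hB : B ∈ P) {p q : Fin t} (hpq : p ≠ q) (hp : p ∈ B) (hq : q ∈ B) :
    ∑ F ∈ forestsOn P with F.Adj p q, mass w F
      = ∑ A ∈ B.powerset with p ∈ A ∧ q ∉ A,
          w p * w q * ∑ F ∈ forestsOn (splitBlock P B A), mass w F := by
  simp only [mul_sum]
  rw [sum_sigma']
  have hsplit : ∀ A, A ⊆ B → p ∈ A → q ∉ A → ∀ F, components F = splitBlock P B A →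
      component F p = A := by
    intro A hA hpA hqA F hF
    have hP' := hP.splitBlock hB hA hpA hq hqA
    refine hP'.eq_of_mem _ ?_ A (by simp [mem_splitBlock]) p (mem_component.2 .rfl) hpA
    rw [← hF]
    exact component_mem_components F p
  refine sum_bij' (fun F _ => ⟨component (F.deleteEdges {s(p, q)}) p, F.deleteEdges {s(p, q)}⟩)
    (fun x _ => x.2 ⊔ SimpleGraph.edge p q) ?_ ?_ ?_ ?_ ?_
  · intro F hF
    simp only [mem_filter, mem_forestsOn] at hF
    obtain ⟨⟨hac, rfl⟩, hadj⟩ := hF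
    have hnr := not_reachable_deleteEdges hac hadj
    have heq := deleteEdges_sup_edge_eq hadj
    set G := F.deleteEdges {s(p, q)} with hG
    simp only [mem_sigma, mem_filter, mem_powerset, mem_forestsOn]
    refine ⟨⟨?_, mem_component.2 .rfl, fun h => hnr (mem_component.1 h)⟩,
      hac.anti (SimpleGraph.deleteEdges_le _), ?_⟩
    · exact component_subset_of_sup_edge (q := q) (by rwa [heq]) hp
    · rw [components_eq_splitBlock hnr (by rwa [heq]) hp hq, heq]
  · rintro ⟨A, F⟩ hF
    simp only [mem_sigma, mem_filter, mem_powerset, mem_forestsOn] at hF ⊢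
    obtain ⟨⟨hA, hpA, hqA⟩, hac, hc⟩ := hF
    have hnr : ¬ F.Reachable p q := by
      rw [← mem_component, hsplit A hA hpA hqA F hc]
      exact hqA
    exact ⟨⟨hac.sup_edge_of_not_reachable hnr,
      components_sup_edge hP hB hA hpA hq hqA hc⟩, by simp [SimpleGraph.edge_adj, hpq]⟩
  · intro F hF
    exact deleteEdges_sup_edge_eq (mem_filter.1 hF).2
  · rintro ⟨A, F⟩ hF
    simp only [mem_sigma, mem_filter, mem_powerset, mem_forestsOn] at hF
    obtain ⟨⟨hA, hpA, hqA⟩, hac, hc⟩ := hF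
    have hcomp := hsplit A hA hpA hqA F hc
    have hnadj : ¬ F.Adj p q := fun h => hqA (hcomp ▸ mem_component.2 h.reachable)
    simp only [sup_edge_deleteEdges_eq hnadj, hcomp]
  · intro F hF
    simp only [mem_filter, mem_forestsOn] at hF
    have hnr := not_reachable_deleteEdges hF.1.1 hF.2
    conv_lhs => rw [← deleteEdges_sup_edge_eq hF.2]
    exact mass_sup_edge w hpq fun h => hnr h.reachable

/-- The weighted Cayley formula for forests with prescribed components. -/
theorem sum_mass_forestsOn {w : Fin t → ℕ} (hw : ∀ i, 0 < w i) {P : Finset (Finset (Fin t))}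
    (hP : IsBlocks P) :
    ∑ F ∈ forestsOn P, mass w F
      = (∏ i, (w i : ℝ)) * ∏ B ∈ P, treeWeight (fun i => (w i : ℝ)) B := by
  classical
  have hw' : ∀ i, 0 < (w i : ℝ) := fun i => Nat.cast_pos.2 (hw i)
  induction hm : t - #P using Nat.strong_induction_on generalizing P with
  | _ m ih =>
  set N := ∏ i, (w i : ℝ) with hN
  set T := treeWeight (fun i => (w i : ℝ)) with hT
  have hcard1 : ∀ B ∈ P, 1 ≤ #B := fun B hB => (hP.nonempty B hB).card_pos
  have hsum : ∑ B ∈ P, #B = t := by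
    have := hP.sum_card
    rw [Fintype.card_fin] at this
    exact_mod_cast this
  have hle : #P ≤ t := by
    calc #P = ∑ B ∈ P, 1 := by simp
      _ ≤ ∑ B ∈ P, #B := sum_le_sum hcard1
      _ = t := hsum
  rcases hle.eq_or_lt with heq | hlt
  · have hone : ∀ B ∈ P, #B = 1 := by
      have h : ∑ B ∈ P, 1 = ∑ B ∈ P, #B := by rw [hsum, ← card_eq_sum_ones, heq]
      exact fun B hB => ((sum_eq_sum_iff_of_le hcard1).1 h B hB).symm
    have hPeq : P = univ.image fun v => {v} := by
      ext B
      simp only [mem_image, mem_univ, true_and]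
      constructor
      · intro hB
        obtain ⟨v, rfl⟩ := card_eq_one.1 (hone B hB)
        exact ⟨v, rfl⟩
      · rintro ⟨v, rfl⟩
        obtain ⟨C, hC, hv⟩ := hP.exists_mem v
        obtain ⟨u, rfl⟩ := card_eq_one.1 (hone C hC)
        rwa [mem_singleton.1 hv]
    have hforests : forestsOn P = {⊥} := by
      ext F
      rw [mem_forestsOn, mem_singleton]
      constructor
      · rintro ⟨-, hc⟩
        by_contra hne
        obtain ⟨p, q, hadj⟩ := SimpleGraph.ne_bot_iff_exists_adj.1 hne
        obtain ⟨B, hB, hpB, hqB⟩ := reachable_iff_mem_components.1 hadj.reachable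
        rw [hc] at hB
        exact hadj.ne (card_le_one.1 (hone B hB).le p hpB q hqB)
      · rintro rfl
        exact ⟨SimpleGraph.isAcyclic_bot, by rw [components_bot, hPeq]⟩
    rw [hforests, sum_singleton, hPeq, prod_image singleton_injective.injOn, hN, ← prod_mul_distrib]
    refine prod_congr rfl fun i _ => ?_
    have := hw' i
    simp [hT, treeWeight, deg]
    field_simp
  · have hdeg : ∀ F ∈ forestsOn P, mass w F * (2 * ((t : ℝ) - #P))
        = ∑ B ∈ P, ∑ e ∈ B.offDiag, if F.Adj e.1 e.2 then mass w F else 0 := by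
      intro F hF
      rw [mem_forestsOn] at hF
      have h1 := sum_deg_add_two_mul_card_components F hF.1
      rw [hF.2] at h1
      have h2 : (2 * ((t : ℝ) - #P)) = ∑ i, (deg F i : ℝ) := by
        have : (∑ i, (deg F i : ℝ)) + 2 * (#P : ℝ) = 2 * t := by exact_mod_cast h1
        linarith
      rw [h2, sum_deg_eq_sum_offDiag hF.2, mul_sum]
      refine sum_congr rfl fun B _ => ?_
      rw [mul_sum]
      exact sum_congr rfl fun e _ => by rw [mul_ite, mul_one, mul_zero]
    have hpos : (0 : ℝ) < 2 * ((t : ℝ) - #P) := by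
      have : (#P : ℝ) < t := by exact_mod_cast hlt
      linarith
    apply mul_right_cancel₀ hpos.ne'
    rw [sum_mul, sum_congr rfl hdeg, sum_comm]
    have hblock : ∀ B ∈ P, ∑ F ∈ forestsOn P, ∑ e ∈ B.offDiag,
        (if F.Adj e.1 e.2 then mass w F else 0) = 2 * (#B - 1 : ℝ) * (N * ∏ C ∈ P, T C) := by
      intro B hB
      rw [sum_comm]
      have hedge : ∀ e ∈ B.offDiag,
          ∑ F ∈ forestsOn P, (if F.Adj e.1 e.2 then mass w F else 0)
            = (∑ A ∈ B.powerset with e.1 ∈ A ∧ e.2 ∉ A,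
                (w e.1 : ℝ) * w e.2 * (T A * T (B \ A))) * (N * ∏ C ∈ P.erase B, T C) := by
        intro e he
        obtain ⟨hp, hq, hpq⟩ := mem_offDiag.1 he
        rw [← sum_filter, sum_mass_adj w hP hB hpq hp hq, sum_mul]
        refine sum_congr rfl fun A hA => ?_
        simp only [mem_filter, mem_powerset] at hA
        obtain ⟨hAB, hpA, hqA⟩ := hA
        rw [ih _ ?_ (hP.splitBlock hB hAB hpA hq hqA) rfl,
          hP.prod_splitBlock hB hAB hpA hq hqA]
        · ring
        · rw [hP.card_splitBlock hB hAB hpA hq hqA]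
          omega
      rw [sum_congr rfl hedge, ← sum_mul, sum_offDiag_sum_treeWeight hw' (hP.nonempty B hB),
        ← mul_prod_erase P T hB]
      ring
    rw [sum_congr rfl hblock, ← sum_mul, ← mul_sum, sum_sub_distrib, hP.sum_card]
    simp
    ring

end Forests

section Comparison

variable {V : Type*} [Fintype V]

theorem prod_treeWeight_le [DecidableEq V] {w : V → ℝ} (hw : ∀ i, 1 ≤ w i)
    (hV : 2 ≤ Fintype.card V) {P : Finset (Finset V)} (hP : IsBlocks P) :
    ∏ B ∈ P, treeWeight w B
      ≤ ((∑ i, w i) / Fintype.card V) ^ (Fintype.card V - 2)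
        * ∏ B ∈ P, treeWeight (fun _ => 1) B := by
  set γ := (∑ i, w i) / Fintype.card V with hγ
  set m : Finset V → ℝ := fun B => (∑ i ∈ B, w i) / #B with hm
  have hVpos : (0 : ℝ) < Fintype.card V := by exact_mod_cast (by omega : 0 < Fintype.card V)
  have hbpos : ∀ B ∈ P, (0 : ℝ) < #B := fun B hB => by exact_mod_cast (hP.nonempty B hB).card_pos
  have hcardle : ∀ B : Finset V, (#B : ℝ) ≤ ∑ i ∈ B, w i := by
    intro B
    simpa using card_nsmul_le_sum B w 1 fun i _ => hw i
  have hm1 : ∀ B ∈ P, 1 ≤ m B := fun B hB => (one_le_div (hbpos B hB)).2 (hcardle B)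
  have hγ1 : 1 ≤ γ := (one_le_div hVpos).2 (hcardle univ)
  have hγ0 : 0 < γ := by linarith
  have hmn : ∀ B ∈ P, (#B : ℝ) * m B = ∑ i ∈ B, w i := fun B hB =>
    mul_div_cancel₀ _ (hbpos B hB).ne'
  have hsum : ∑ B ∈ P, (#B : ℝ) * m B = γ * Fintype.card V := by
    rw [sum_congr rfl hmn, hP.sum_blocks, hγ]
    field_simp
  have hamgm : ∏ B ∈ P, m B ^ #B ≤ γ ^ Fintype.card V := by
    have h1 : ∏ B ∈ P, (m B / γ) ^ #B ≤ ∏ B ∈ P, Real.exp (#B * (m B / γ - 1)) := by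
      refine prod_le_prod (fun B hB => ?_) fun B hB => ?_
      · have := hm1 B hB; positivity
      · rw [Real.exp_nat_mul]
        have := hm1 B hB
        gcongr
        linarith [Real.add_one_le_exp (m B / γ - 1)]
    have h2 : ∑ B ∈ P, (#B : ℝ) * (m B / γ - 1) = 0 := by
      have : ∀ B ∈ P, (#B : ℝ) * (m B / γ - 1) = (#B * m B) / γ - #B := fun B _ => by ring
      rw [sum_congr rfl this, sum_sub_distrib, ← sum_div, hsum, hP.sum_card]
      field_simp
      ring
    rw [← Real.exp_sum, h2, Real.exp_zero] at h1
    simp only [div_pow, prod_div_distrib, prod_pow_eq_pow_sum] at h1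
    have hc : ∑ B ∈ P, #B = Fintype.card V := by exact_mod_cast hP.sum_card
    rwa [hc, div_le_one (by positivity)] at h1
  have hmax : γ ≤ ∏ B ∈ P, m B := by
    obtain ⟨B, hB, hmB⟩ : ∃ B ∈ P, γ ≤ m B := by
      by_contra! hlt
      have hne : P.Nonempty := by
        rw [nonempty_iff_ne_empty]
        rintro rfl
        have := hP.sum_card
        rw [sum_empty] at this
        exact hVpos.ne this
      have : ∑ B ∈ P, (#B : ℝ) * m B < ∑ B ∈ P, (#B : ℝ) * γ :=
        sum_lt_sum_of_nonempty hne fun B hB => mul_lt_mul_of_pos_left (hlt B hB) (hbpos B hB)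
      rw [hsum, ← sum_mul, hP.sum_card, mul_comm] at this
      exact this.false
    rw [← mul_prod_erase P m hB]
    have : 1 ≤ ∏ C ∈ P.erase B, m C :=
      Finset.one_le_prod fun C hC => hm1 C (mem_of_mem_erase hC)
    nlinarith
  have hT : ∀ B ∈ P, treeWeight w B = treeWeight (fun _ => 1) B * (m B ^ #B / m B ^ 2) := by
    intro B hB
    have h1 := hbpos B hB
    have h2 := hm1 B hB
    have h3 : m B ≠ 0 := by linarith
    rw [treeWeight, treeWeight, ← hmn B hB]
    simp only [sum_const, nsmul_eq_mul, mul_one, mul_pow]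
    field_simp
  rw [prod_congr rfl hT, prod_mul_distrib, mul_comm]
  refine mul_le_mul_of_nonneg_right ?_ (prod_nonneg fun B _ => by rw [treeWeight]; positivity)
  rw [prod_div_distrib, prod_pow, div_le_iff₀ (by have := hγ0.trans_le hmax; positivity)]
  calc ∏ B ∈ P, m B ^ #B ≤ γ ^ Fintype.card V := hamgm
    _ = γ ^ (Fintype.card V - 2) * γ ^ 2 := by rw [← pow_add, Nat.sub_add_cancel hV]
    _ ≤ γ ^ (Fintype.card V - 2) * (∏ B ∈ P, m B) ^ 2 := by gcongr

end Comparison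

theorem mass_forests_le (t : ℕ) (ht : 3 ≤ t) (w : Fin t → ℕ) (hw : ∀ i, 0 < w i) :
    massSet w {F : SimpleGraph (Fin t) | F.IsAcyclic}
      ≤ (∏ i, (w i : ℝ)) * ((∑ i, (w i : ℝ)) / (t : ℝ)) ^ (t - 2)
          * ({F : SimpleGraph (Fin t) | F.IsAcyclic}.ncard : ℝ) := by
  classical
  set S : Finset (SimpleGraph (Fin t)) := univ.filter fun F => F.IsAcyclic with hS
  have hset : {F : SimpleGraph (Fin t) | F.IsAcyclic} = S := by ext F; simp [hS]
  have hfiber : ∀ P, S.filter (fun F => components F = P) = forestsOn P := by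
    intro P
    ext F
    simp [hS, mem_forestsOn]
  have hmaps : ∀ F ∈ S, components F ∈ S.image components := fun F hF => mem_image_of_mem _ hF
  rw [massSet, hset, finsum_mem_coe_finset, Set.ncard_coe_finset, card_eq_sum_ones,
    ← sum_fiberwise_of_maps_to hmaps, ← sum_fiberwise_of_maps_to hmaps (fun _ => 1), Nat.cast_sum,
    mul_sum]
  refine sum_le_sum fun P hP => ?_
  obtain ⟨F, -, rfl⟩ := mem_image.1 hP
  have hblocks := isBlocks_components F
  have hcount := sum_mass_forestsOn (w := fun _ : Fin t => 1) (fun _ => Nat.one_pos) hblocks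
  have hle := prod_treeWeight_le (w := fun i => (w i : ℝ)) (fun i => by exact_mod_cast hw i)
    (by rw [Fintype.card_fin]; omega) hblocks
  rw [Fintype.card_fin] at hle
  simp only [mass, Nat.cast_one, one_pow, prod_const_one, one_mul] at hcount
  rw [hfiber, sum_mass_forestsOn hw hblocks, Nat.cast_sum, Nat.cast_one, hcount, mul_assoc]
  exact mul_le_mul_of_nonneg_left hle (prod_nonneg fun i _ => Nat.cast_nonneg _)
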